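/- arXiv:2603.08539 — 5 statements merged into one kernel-verified Lean document; each statement's English description precedes it below -/
import Mathlib

section
/- Let n, d be positive integers, G a connected subgraph of K_{n,d}, and M a G-tropical oriented matroid. Then for every type A ∈ M there exists a type B ∈ M whose graph E(B) is connected and which contains A, i.e. A_i ⊆ B_i for every i ∈ Fin n. -/
open Finset Pointwise

/-- The bipartite graph on vertex set `α ⊕ β` whose edges are the pairs in `S`. -/
def bipGraph {α β : Type*} (S : Set (α × β)) : SimpleGraph (α ⊕ β) where
  Adj u v := ∃ a b, (a, b) ∈ S ∧
    ((u = Sum.inl a ∧ v = Sum.inr b) ∨ (u = Sum.inr b ∧ v = Sum.inl a))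
  symm := by
    refine ⟨?_⟩
    rintro u v ⟨a, b, h, (⟨rfl, rfl⟩ | ⟨rfl, rfl⟩)⟩
    · exact ⟨a, b, h, Or.inr ⟨rfl, rfl⟩⟩
    · exact ⟨a, b, h, Or.inl ⟨rfl, rfl⟩⟩
  loopless := by
    refine ⟨?_⟩
    rintro u ⟨a, b, h, (⟨rfl, hv⟩ | ⟨rfl, hv⟩)⟩ <;> simp at hv

/-- The edge set of an `(n,d)`-type. -/
def typeEdges {n d : ℕ} (A : Fin n → Finset (Fin d)) : Set (Fin n × Fin d) :=
  {p | p.2 ∈ A p.1}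

/-- A subgraph of `K_{n,d}` is connected. -/
def IsConn {n d : ℕ} (S : Set (Fin n × Fin d)) : Prop :=
  (bipGraph S).Connected

/-- `A` is an `(n,d)`-type: every coordinate is nonempty. -/
def IsType {n d : ℕ} (A : Fin n → Finset (Fin d)) : Prop := ∀ i, (A i).Nonempty

/-- Compatibility of two subgraphs of `K_{n,d}`. -/
def Compatible {n d : ℕ} (A B : Set (Fin n × Fin d)) : Prop :=
  ∀ (k : ℕ) (i : Fin (k + 2) → Fin n) (j : Fin (k + 2) → Fin d),
    Function.Injective i → Function.Injective j →
    (∀ t, (i t, j t) ∈ A) → (∀ t, (i (t + 1), j t) ∈ B) →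
    ∀ t, (i t, j t) ∈ A ∧ (i t, j t) ∈ B ∧ (i (t + 1), j t) ∈ A ∧ (i (t + 1), j t) ∈ B

/-- An ordered partition of `Fin d` into nonempty parts. -/
structure OrderedPartition (d : ℕ) where
  r : ℕ
  parts : Fin r → Finset (Fin d)
  nonempty : ∀ k, (parts k).Nonempty
  disjoint : ∀ k l, k ≠ l → Disjoint (parts k) (parts l)
  covers : ∀ j, ∃ k, j ∈ parts k

/-- `B` is the refinement of `A` with respect to the ordered partition `P`. -/
def IsRefinement {n d : ℕ} (A : Fin n → Finset (Fin d)) (P : OrderedPartition d)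
    (B : Fin n → Finset (Fin d)) : Prop :=
  ∀ i, ∃ k, B i = A i ∩ P.parts k ∧ (A i ∩ P.parts k).Nonempty ∧
    ∀ l, l < k → A i ∩ P.parts l = ∅

/-- `B` is the total refinement of `A` with respect to the linear order on `Fin d` whose
rank function is `σ`. -/
def IsTotalRefinement {n d : ℕ} (A : Fin n → Finset (Fin d)) (σ : Equiv.Perm (Fin d))
    (B : Fin n → Finset (Fin d)) : Prop :=
  ∀ i, ∃ j ∈ A i, B i = {j} ∧ ∀ j' ∈ A i, σ j ≤ σ j'

/-- The type associated to a subgraph `G` of `K_{n,d}`. -/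
def graphType {n d : ℕ} (G : Finset (Fin n × Fin d)) : Fin n → Finset (Fin d) :=
  fun i => Finset.univ.filter fun j => (i, j) ∈ G

/-- `M` is a `G`-tropical oriented matroid. -/
structure IsGTOM {n d : ℕ} (G : Finset (Fin n × Fin d))
    (M : Set (Fin n → Finset (Fin d))) : Prop where
  isType : ∀ A ∈ M, IsType A
  subgraph : ∀ A ∈ M, typeEdges A ⊆ (↑G : Set (Fin n × Fin d))
  boundary : ∀ (σ : Equiv.Perm (Fin d)) (B : Fin n → Finset (Fin d)),
    IsTotalRefinement (graphType G) σ B → B ∈ M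
  surrounding : ∀ A ∈ M, ∀ (P : OrderedPartition d) (B : Fin n → Finset (Fin d)),
    IsRefinement A P B → B ∈ M
  comparability : ∀ A ∈ M, ∀ B ∈ M, Compatible (typeEdges A) (typeEdges B)
  elimination : ∀ A ∈ M, ∀ B ∈ M, ∀ i : Fin n, ∃ C ∈ M,
    C i = A i ∪ B i ∧ ∀ i', C i' = A i' ∨ C i' = B i' ∨ C i' = A i' ∪ B i'

/-- The vertex of `Δ^{n-1} × Δ^{d-1}` associated to a pair `(i, j)`. -/
def rootVert {n d : ℕ} (p : Fin n × Fin d) : (Fin n → ℝ) × (Fin d → ℝ) :=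
  (Pi.single p.1 1, Pi.single p.2 1)

/-- The root polytope `Q_S` of a subgraph `S ⊆ K_{n,d}`. -/
def rootPoly {n d : ℕ} (S : Set (Fin n × Fin d)) : Set ((Fin n → ℝ) × (Fin d → ℝ)) :=
  convexHull ℝ (rootVert '' S)

/-- A collection `𝒢` of subgraphs encodes a polyhedral subdivision of `Q_G`. -/
def EncodesSubdivision {n d : ℕ} (G : Set (Fin n × Fin d))
    (𝒢 : Set (Set (Fin n × Fin d))) : Prop :=
  (⋃ S ∈ 𝒢, rootPoly S) = rootPoly G ∧
  ∀ S ∈ 𝒢, ∀ T ∈ 𝒢, IsExtreme ℝ (rootPoly S) (rootPoly S ∩ rootPoly T) ∧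
    IsExtreme ℝ (rootPoly T) (rootPoly S ∩ rootPoly T)

/-- Connectivity of the edge set `S` restricted to the vertex sets `I ⊕ J`. -/
def connOn {n d : ℕ} (I : Set (Fin n)) (J : Set (Fin d)) (S : Set (Fin n × Fin d)) : Prop :=
  (bipGraph {p : ↥I × ↥J | ((p.1 : Fin n), (p.2 : Fin d)) ∈ S}).Connected

/-- The generalized permutohedron (Minkowski sum of faces of the simplex). -/
def gPerm {n d : ℕ} (J : Fin n → Finset (Fin d)) : Set (Fin d → ℝ) :=
  ∑ i : Fin n, convexHull ℝ ((fun j => Pi.single j (1 : ℝ)) '' ↑(J i))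

/-- Closure of a set of types under elimination. -/
def ElimClosed {n d : ℕ} (N : Set (Fin n → Finset (Fin d))) : Prop :=
  ∀ A ∈ N, ∀ B ∈ N, ∀ i : Fin n, ∃ C ∈ N,
    C i = A i ∪ B i ∧ ∀ i', C i' = A i' ∨ C i' = B i' ∨ C i' = A i' ∪ B i'

/-- The boundary axiom phrased with an injective key. -/
def KeyBoundary {n d : ℕ} (H : Fin n → Finset (Fin d))
    (N : Set (Fin n → Finset (Fin d))) : Prop :=
  ∀ key : Fin d → ℕ, Function.Injective key → ∀ B : Fin n → Finset (Fin d),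
    (∀ i, ∃ j ∈ H i, B i = {j} ∧ ∀ j' ∈ H i, key j ≤ key j') → B ∈ N

lemma keyBoundary_of_perm {n d : ℕ} (H : Fin n → Finset (Fin d))
    (N : Set (Fin n → Finset (Fin d)))
    (h : ∀ (σ : Equiv.Perm (Fin d)) (B : Fin n → Finset (Fin d)),
      IsTotalRefinement H σ B → B ∈ N) : KeyBoundary H N := by
  intro key hkey B hB
  apply h (Tuple.sort key).symm B
  intro i
  obtain ⟨j, hj, hBi, hmin⟩ := hB i
  refine ⟨j, hj, hBi, fun j' hj' => ?_⟩
  by_contra hlt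
  push Not at hlt
  have hm := Tuple.monotone_sort key hlt.le
  simp only [Function.comp, Equiv.apply_symm_apply] at hm
  have := hkey (le_antisymm (hmin j' hj') hm)
  subst this
  exact lt_irrefl _ hlt

/-- Refinement of a single coordinate by the ordered partition `(F, Fᶜ)`. -/
def refSet {d : ℕ} (F X : Finset (Fin d)) : Finset (Fin d) :=
  if (X ∩ F).Nonempty then X ∩ F else X

lemma refSet_subset {d : ℕ} (F X : Finset (Fin d)) : refSet F X ⊆ X := by
  unfold refSet
  split_ifs
  · exact Finset.inter_subset_left
  · exact Finset.Subset.refl _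

lemma refSet_nonempty {d : ℕ} (F X : Finset (Fin d)) (h : X.Nonempty) :
    (refSet F X).Nonempty := by
  unfold refSet
  split_ifs with h1
  · exact h1
  · exact h

lemma refSet_of_mem {d : ℕ} {F X : Finset (Fin d)} {x : Fin d} (h : x ∈ X) (h' : x ∈ F) :
    refSet F X = X ∩ F := by
  unfold refSet
  rw [if_pos ⟨x, Finset.mem_inter.2 ⟨h, h'⟩⟩]

/-- The members of `N` contained in `H`. -/
def below {n d : ℕ} (H : Fin n → Finset (Fin d))
    (N : Set (Fin n → Finset (Fin d))) : Set (Fin n → Finset (Fin d)) :=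
  {D | D ∈ N ∧ ∀ i, D i ⊆ H i}

lemma keyBoundary_ref {n d : ℕ} (H : Fin n → Finset (Fin d))
    (N : Set (Fin n → Finset (Fin d))) (F : Finset (Fin d)) (h : KeyBoundary H N) :
    KeyBoundary (fun i => refSet F (H i)) (below (fun i => refSet F (H i)) N) := by
  intro key hkey B hB
  refine ⟨?_, ?_⟩
  · obtain ⟨m, hm⟩ : ∃ m, ∀ j, key j < m := by
      refine ⟨(Finset.univ.sup key) + 1, fun j => ?_⟩
      exact Nat.lt_succ_of_le (Finset.le_sup (f := key) (Finset.mem_univ j))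
    apply h (fun j => if j ∈ F then key j else m + key j)
    · intro a b hab
      have ha := hm a
      have hb := hm b
      dsimp only at hab
      apply hkey
      split_ifs at hab <;> omega
    · intro i
      obtain ⟨j, hj, hBi, hmin⟩ := hB i
      refine ⟨j, refSet_subset _ _ hj, hBi, fun j' hj' => ?_⟩
      have h1 := hm j
      have h2 := hm j'
      dsimp only at hj hmin ⊢
      by_cases hne : (H i ∩ F).Nonempty
      · simp only [refSet, if_pos hne, Finset.mem_inter] at hj hmin
        rw [if_pos hj.2]
        split_ifs with hF
        · exact hmin j' ⟨hj', hF⟩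
        · omega
      · have hno : ∀ x ∈ H i, x ∉ F := fun x hx hF =>
          hne ⟨x, Finset.mem_inter.2 ⟨hx, hF⟩⟩
        simp only [refSet, if_neg hne] at hj hmin
        rw [if_neg (hno j hj), if_neg (hno j' hj')]
        have := hmin j' hj'
        omega
  · intro i
    obtain ⟨j, hj, hBi, _⟩ := hB i
    rw [hBi]
    exact Finset.singleton_subset_iff.2 hj

lemma elimClosed_below {n d : ℕ} (H : Fin n → Finset (Fin d))
    (N : Set (Fin n → Finset (Fin d))) (h : ElimClosed N) : ElimClosed (below H N) := by
  intro A hA B hB i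
  obtain ⟨C, hC, hCi, hCo⟩ := h A hA.1 B hB.1 i
  refine ⟨C, ⟨hC, fun i' => ?_⟩, hCi, hCo⟩
  rcases hCo i' with h | h | h <;> rw [h]
  · exact hA.2 i'
  · exact hB.2 i'
  · exact Finset.union_subset (hA.2 i') (hB.2 i')

/-- Existence of a directed cycle. -/
lemma cycle_contra {n d : ℕ} (A : Fin n → Finset (Fin d)) (R : Finset (Fin n)) (hR : R.Nonempty)
    (f w : Fin n → Fin d) (hfA : ∀ i ∈ R, f i ∈ A i)
    (hw : ∀ i ∈ R, w i ∈ R.image f) (hwf : ∀ i ∈ R, w i ≠ f i)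
    (D : Fin n → Fin n → Finset (Fin d))
    (hc : ∀ l ∈ R, Compatible (typeEdges A) (typeEdges (D l)))
    (hDw : ∀ l ∈ R, ∀ k ∈ R, w k ∈ D l k) : ∃ l ∈ R, f l ∈ D l l := by
  classical
  have hs : ∀ c : Fin d, ∃ r : Fin n, c ∈ R.image f → r ∈ R ∧ f r = c := by
    intro c
    by_cases h : c ∈ R.image f
    · obtain ⟨r, hr, hrc⟩ := Finset.mem_image.1 h
      exact ⟨r, fun _ => ⟨hr, hrc⟩⟩
    · exact ⟨hR.choose, fun h' => absurd h' h⟩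
  choose s hs using hs
  let p : Fin n → Fin n := fun k => s (w k)
  have hpR : ∀ k ∈ R, p k ∈ R := fun k hk => (hs _ (hw k hk)).1
  have hpf : ∀ k ∈ R, f (p k) = w k := fun k hk => (hs _ (hw k hk)).2
  obtain ⟨r, hr⟩ := hR
  have hit : ∀ (x : Fin n), x ∈ R → ∀ m, p^[m] x ∈ R := by
    intro x hx m
    induction m with
    | zero => exact hx
    | succ m ih => rw [Function.iterate_succ_apply']; exact hpR _ ih
  obtain ⟨a, b, hab, heq⟩ := Finite.exists_ne_map_eq_of_infinite (fun m : ℕ => p^[m] r)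
  have key : ∃ x ∈ R, x ∈ Function.periodicPts p := by
    rcases lt_or_gt_of_ne hab with h | h
    · refine ⟨p^[a] r, hit r hr a, b - a, by omega, ?_⟩
      show p^[b - a] (p^[a] r) = _
      rw [← Function.iterate_add_apply, Nat.sub_add_cancel h.le]
      exact heq.symm
    · refine ⟨p^[b] r, hit r hr b, a - b, by omega, ?_⟩
      show p^[a - b] (p^[b] r) = _
      rw [← Function.iterate_add_apply, Nat.sub_add_cancel h.le]
      exact heq
  obtain ⟨x, hx, hxp⟩ := key
  set L := Function.minimalPeriod p x with hL
  have hLpos : 0 < L := Function.minimalPeriod_pos_of_mem_periodicPts hxp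
  have hL1 : L ≠ 1 := by
    intro h1
    have : p x = x := Function.minimalPeriod_eq_one_iff_isFixedPt.1 h1
    apply hwf x hx
    rw [← hpf x hx, this]
  obtain ⟨k, hk⟩ : ∃ k, L = k + 2 := ⟨L - 2, by omega⟩
  have hinj : ∀ a b : ℕ, a < L → b < L → p^[a] x = p^[b] x → a = b := by
    intro a b ha hb h
    exact Function.iterate_injOn_Iio_minimalPeriod ha hb h
  have hper : p^[L] x = x := Function.isPeriodicPt_minimalPeriod p x
  -- the cycle, traversed backwards
  let i : Fin (k + 2) → Fin n := fun t => p^[k + 1 - t.val] x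
  have hiR : ∀ t, i t ∈ R := fun t => hit x hx _
  have hstep : ∀ t, p (i (t + 1)) = i t := by
    intro t
    show p (p^[_] x) = p^[_] x
    rw [← Function.iterate_succ_apply' p]
    by_cases ht : t = Fin.last (k + 1)
    · subst ht
      simp only [Fin.last_add_one, Fin.val_zero, Fin.val_last]
      have : (k + 1 - 0).succ = L := by omega
      rw [this, hper]
      simp
    · have hlt : t.val < k + 1 := by
        have := t.2
        have h2 : t.val ≠ k + 1 := fun h => ht (Fin.ext h)
        omega
      rw [Fin.val_add_one, if_neg ht]
      congr 1
      congr 1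
      omega
  have hi : Function.Injective i := by
    intro a b hab
    have := hinj (k + 1 - a.val) (k + 1 - b.val) (by omega) (by omega) hab
    apply Fin.ext
    have := a.2
    have := b.2
    omega
  have hj : Function.Injective (fun t => f (i t)) := by
    intro a b hab
    dsimp only at hab
    apply hi
    rw [← hstep a, ← hstep b] at hab ⊢
    rw [hpf _ (hiR _), hpf _ (hiR _)] at hab
    show s _ = s _
    rw [hab]
  have := hc (i 0) (hiR 0) k i (fun t => f (i t)) hi hj (fun t => hfA _ (hiR t))
    (fun t => by
      show f (i t) ∈ D (i 0) (i (t + 1))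
      rw [← hstep t, hpf _ (hiR _)]
      exact hDw _ (hiR _) _ (hiR _)) 0
  exact ⟨i 0, hiR 0, this.2.1⟩

lemma cover_aux {n d : ℕ} (A : Fin n → Finset (Fin d)) (f : Fin n → Fin d) (m : ℕ) :
    ∀ (R : Finset (Fin n)) (H : Fin n → Finset (Fin d)) (N : Set (Fin n → Finset (Fin d))),
    R.card = m → (∀ i, (H i).Nonempty) → (∀ D ∈ N, ∀ i, (D i).Nonempty) →
    (∀ D ∈ N, Compatible (typeEdges A) (typeEdges D)) → ElimClosed N → KeyBoundary H N →
    (∀ i ∈ R, f i ∈ A i) → (∀ i ∈ R, f i ∈ H i) → ∃ D ∈ N, ∀ i ∈ R, f i ∈ D i := by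
  classical
  induction m with
  | zero =>
    intro R H N hcard hH hN hc he hb hfA hfH
    have hR : R = ∅ := Finset.card_eq_zero.1 hcard
    subst hR
    have hmin : ∀ i, ∃ j ∈ H i, ∀ j' ∈ H i, (j : ℕ) ≤ j' := fun i =>
      Finset.exists_min_image (H i) (fun j => (j : ℕ)) (hH i)
    choose g hg hg' using hmin
    exact ⟨fun i => {g i}, hb (fun j => (j : ℕ)) Fin.val_injective _
      (fun i => ⟨g i, hg i, rfl, hg' i⟩), by simp⟩
  | succ m ih =>
    intro R H N hcard hH hN hc he hb hfA hfH
    set F := R.image f with hF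
    set H' : Fin n → Finset (Fin d) := fun i => refSet F (H i) with hH'
    have hfF : ∀ i ∈ R, f i ∈ F := fun i hi => Finset.mem_image_of_mem f hi
    have hH'eq : ∀ i ∈ R, H' i = H i ∩ F := fun i hi => refSet_of_mem (hfH i hi) (hfF i hi)
    set N' := below H' N with hN'
    have he' : ElimClosed N' := elimClosed_below H' N he
    have hb' : KeyBoundary H' N' := keyBoundary_ref H N F hb
    by_contra hcon
    have hno : ¬ ∃ D ∈ N', ∀ i ∈ R, f i ∈ D i := fun ⟨D, hD, h⟩ => hcon ⟨D, hD.1, h⟩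
    have hD0 : ∀ l, ∃ D, l ∈ R → D ∈ N' ∧ ∀ i ∈ R, i ≠ l → f i ∈ D i := by
      intro l
      by_cases hl : l ∈ R
      · obtain ⟨D, hD, h⟩ := ih (R.erase l) H' N' (by rw [Finset.card_erase_of_mem hl]; omega)
          (fun i => refSet_nonempty _ _ (hH i)) (fun D hD => hN D hD.1)
          (fun D hD => hc D hD.1) he' hb'
          (fun i hi => hfA i (Finset.mem_of_mem_erase hi))
          (fun i hi => by
            have hi' := Finset.mem_of_mem_erase hi
            rw [hH'eq i hi']
            exact Finset.mem_inter.2 ⟨hfH i hi', hfF i hi'⟩)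
        exact ⟨D, fun _ => ⟨hD, fun i hi hil => h i (Finset.mem_erase.2 ⟨hil, hi⟩)⟩⟩
      · exact ⟨H, fun h => absurd h hl⟩
    choose D0 hD0 using hD0
    have hw0 : ∀ l, ∃ x, l ∈ R → x ∈ D0 l l := by
      intro l
      by_cases hl : l ∈ R
      · obtain ⟨x, hx⟩ := hN _ (hD0 l hl).1.1 l
        exact ⟨x, fun _ => hx⟩
      · exact ⟨f l, fun h => absurd h hl⟩
    choose w hw0 using hw0
    have hsat : ∀ Q : Finset (Fin n), Q ⊆ R → ∃ D : Fin n → Fin n → Finset (Fin d),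
        ∀ l ∈ R, D l ∈ N' ∧ (∀ i ∈ R, i ≠ l → f i ∈ D l i) ∧ w l ∈ D l l ∧
          ∀ k ∈ Q, w k ∈ D l k := by
      intro Q
      induction Q using Finset.induction_on with
      | empty =>
        intro _
        exact ⟨D0, fun l hl => ⟨(hD0 l hl).1, (hD0 l hl).2, hw0 l hl, by simp⟩⟩
      | insert q Q hqQ ihQ =>
        intro hQR
        have hq : q ∈ R := hQR (Finset.mem_insert_self _ _)
        obtain ⟨D, hD⟩ := ihQ (fun x hx => hQR (Finset.mem_insert_of_mem hx))
        have hnew : ∀ l, ∃ E : Fin n → Finset (Fin d), l ∈ R →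
            E ∈ N' ∧ (∀ i ∈ R, i ≠ l → f i ∈ E i) ∧ w l ∈ E l ∧
              ∀ k ∈ insert q Q, w k ∈ E k := by
          intro l
          by_cases hl : l ∈ R
          swap
          · exact ⟨H, fun h => absurd h hl⟩
          obtain ⟨hl1, hl2, hl3, hl4⟩ := hD l hl
          obtain ⟨hq1, hq2, hq3, hq4⟩ := hD q hq
          by_cases hlq : l = q
          · subst hlq
            refine ⟨D l, fun _ => ⟨hl1, hl2, hl3, fun k hk => ?_⟩⟩
            rcases Finset.mem_insert.1 hk with rfl | hk
            · exact hl3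
            · exact hl4 k hk
          · obtain ⟨C, hC, hCq, hCo⟩ := he' (D l) hl1 (D q) hq1 q
            have hCf : ∀ i ∈ R, i ≠ l → f i ∈ C i := by
              intro i hi hil
              by_cases hiq : i = q
              · subst hiq
                rw [hCq]
                exact Finset.mem_union_left _ (hl2 i hi hil)
              · rcases hCo i with h | h | h <;> rw [h]
                · exact hl2 i hi hil
                · exact hq2 i hi hiq
                · exact Finset.mem_union_left _ (hl2 i hi hil)
            have hCl : C l = D l l := by
              rcases hCo l with h | h | h
              · exact h
              all_goals
                exfalso
                apply hno
                refine ⟨C, hC, fun i hi => ?_⟩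
                by_cases hil : i = l
                · subst hil
                  rw [h]
                  first
                  | exact hq2 i hi hlq
                  | exact Finset.mem_union_right _ (hq2 i hi hlq)
                · exact hCf i hi hil
            refine ⟨C, fun _ => ⟨hC, hCf, by rw [hCl]; exact hl3, fun k hk => ?_⟩⟩
            rcases Finset.mem_insert.1 hk with rfl | hk
            · rw [hCq]
              exact Finset.mem_union_right _ hq3
            · rcases hCo k with h | h | h <;> rw [h]
              · exact hl4 k hk
              · exact hq4 k hk
              · exact Finset.mem_union_left _ (hl4 k hk)
        choose E hE using hnew
        exact ⟨E, hE⟩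
    obtain ⟨D, hD⟩ := hsat R (Finset.Subset.refl _)
    have hRne : R.Nonempty := Finset.card_pos.1 (by omega)
    have hnot : ∀ l ∈ R, f l ∉ D l l := by
      intro l hl hfl
      apply hno
      refine ⟨D l, (hD l hl).1, fun i hi => ?_⟩
      by_cases hil : i = l
      · subst hil
        exact hfl
      · exact (hD l hl).2.1 i hi hil
    obtain ⟨l, hl, hfl⟩ := cycle_contra A R hRne f w hfA
      (fun i hi => by
        have h1 := (hD i hi).1.2 i (hD i hi).2.2.1
        rw [hH'eq i hi] at h1
        exact (Finset.mem_inter.1 h1).2)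
      (fun i hi h => hnot i hi (h ▸ (hD i hi).2.2.1)) D
      (fun l hl => hc _ (hD l hl).1.1) (fun l hl k hk => (hD l hl).2.2.2 k hk)
    exact hnot l hl hfl

/-- Combining selections by elimination. -/
lemma combine {n d : ℕ} (A : Fin n → Finset (Fin d)) (N : Set (Fin n → Finset (Fin d)))
    (he : ElimClosed N) (hA : ∀ i, (A i).Nonempty) (Q : Finset (Fin n))
    (h : ∀ f : Fin n → Fin d, (∀ i, f i ∈ A i) → ∃ D ∈ N, ∀ i ∈ Q, f i ∈ D i) :
    ∃ D ∈ N, ∀ i ∈ Q, A i ⊆ D i := by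
  classical
  have main : ∀ Q' : Finset (Fin n), Q' ⊆ Q → ∀ f : Fin n → Fin d, (∀ i, f i ∈ A i) →
      ∃ D ∈ N, (∀ i ∈ Q', A i ⊆ D i) ∧ ∀ i ∈ Q, f i ∈ D i := by
    intro Q'
    induction Q' using Finset.induction_on with
    | empty =>
      intro _ f hf
      obtain ⟨D, hD, h'⟩ := h f hf
      exact ⟨D, hD, by simp, h'⟩
    | insert q Q' hq ih =>
      intro hQ f hf
      have hqQ : q ∈ Q := hQ (Finset.mem_insert_self _ _)
      have ih' := ih (fun x hx => hQ (Finset.mem_insert_of_mem hx))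
      have inner : ∀ X : Finset (Fin d), X ⊆ A q → ∃ D ∈ N, (∀ i ∈ Q', A i ⊆ D i) ∧
          (∀ i ∈ Q, f i ∈ D i) ∧ X ⊆ D q := by
        intro X
        induction X using Finset.induction_on with
        | empty =>
          intro _
          obtain ⟨D, hD, h1, h2⟩ := ih' f hf
          exact ⟨D, hD, h1, h2, by simp⟩
        | insert x X hx ihX =>
          intro hXA
          obtain ⟨D, hD, h1, h2, h3⟩ := ihX (fun y hy => hXA (Finset.mem_insert_of_mem hy))
          have hxA : x ∈ A q := hXA (Finset.mem_insert_self _ _)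
          obtain ⟨E, hE, g1, g2⟩ := ih' (Function.update f q x) (fun i => by
            by_cases hi : i = q
            · subst hi
              simpa using hxA
            · simpa [hi] using hf i)
          obtain ⟨C, hC, hCq, hCo⟩ := he D hD E hE q
          refine ⟨C, hC, fun i hi => ?_, fun i hi => ?_, ?_⟩
          · rcases hCo i with h | h | h <;> rw [h]
            · exact h1 i hi
            · exact g1 i hi
            · exact (h1 i hi).trans Finset.subset_union_left
          · by_cases hiq : i = q
            · subst hiq
              rw [hCq]
              exact Finset.mem_union_left _ (h2 i hi)
            · have := g2 i hi
              rw [Function.update_of_ne hiq] at this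
              rcases hCo i with h | h | h <;> rw [h]
              · exact h2 i hi
              · exact this
              · exact Finset.mem_union_left _ (h2 i hi)
          · rw [hCq]
            intro y hy
            rcases Finset.mem_insert.1 hy with rfl | hy
            · have := g2 q hqQ
              rw [Function.update_self] at this
              exact Finset.mem_union_right _ this
            · exact Finset.mem_union_left _ (h3 hy)
      obtain ⟨D, hD, h1, h2, h3⟩ := inner (A q) (Finset.Subset.refl _)
      refine ⟨D, hD, fun i hi => ?_, h2⟩
      rcases Finset.mem_insert.1 hi with rfl | hi
      · exact h3
      · exact h1 i hi
  choose f hf using hA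
  obtain ⟨D, hD, h1, _⟩ := main Q (Finset.Subset.refl _) f hf
  exact ⟨D, hD, h1⟩

/-- Eliminating towards `A` while keeping an edge outside the components of `A`. -/
lemma approach {n d : ℕ} (A : Fin n → Finset (Fin d)) (M : Set (Fin n → Finset (Fin d)))
    (he : ElimClosed M) (hA : A ∈ M) (out : Fin n → Fin d → Prop) (m : ℕ) :
    ∀ D ∈ M, (Finset.univ.filter fun i => ¬ A i ⊆ D i).card = m →
    (∀ i, A i ⊆ D i ∨ ∃ x ∈ D i, out i x) → (∃ i, ∃ x ∈ D i, out i x) →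
    ∃ C ∈ M, (∀ i, A i ⊆ C i) ∧ ∃ i, ∃ x ∈ C i, out i x := by
  classical
  induction m using Nat.strong_induction_on with
  | _ m ih =>
    intro D hD hm h1 h2
    by_cases hall : ∀ i, A i ⊆ D i
    · exact ⟨D, hD, hall, h2⟩
    push Not at hall
    obtain ⟨q, hq⟩ := hall
    obtain ⟨C, hC, hCq, hCo⟩ := he A hA D hD q
    have hkeep : ∀ i, A i ⊆ D i → A i ⊆ C i := by
      intro i hi
      rcases hCo i with h | h | h <;> rw [h]
      · exact hi
      · exact Finset.subset_union_left
    refine ih _ ?_ C hC rfl ?_ ?_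
    · rw [← hm]
      apply Finset.card_lt_card
      refine Finset.ssubset_iff_subset_ne.2 ⟨?_, ?_⟩
      · intro i hi
        simp only [Finset.mem_filter, Finset.mem_univ, true_and] at hi ⊢
        exact fun h => hi (hkeep i h)
      · intro heq
        have : q ∈ Finset.univ.filter fun i => ¬ A i ⊆ C i := by
          rw [heq]
          simpa using hq
        simp only [Finset.mem_filter, Finset.mem_univ, true_and] at this
        apply this
        rw [hCq]
        exact Finset.subset_union_left
    · intro i
      rcases hCo i with h | h | h <;> rw [h]
      · exact Or.inl (Finset.Subset.refl _)
      · exact h1 i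
      · exact Or.inl Finset.subset_union_left
    · obtain ⟨x, hx, hxo⟩ := (h1 q).resolve_left hq
      exact ⟨q, x, by rw [hCq]; exact Finset.mem_union_right _ hx, hxo⟩

lemma enlarge {n d : ℕ} (G : Finset (Fin n × Fin d)) (M : Set (Fin n → Finset (Fin d)))
    (hM : IsGTOM G M) (A : Fin n → Finset (Fin d)) (hA : A ∈ M)
    (p : Fin n → Prop) (K : Finset (Fin d)) (hp : ∀ i, ∀ j ∈ A i, (p i ↔ j ∉ K))
    (i₀ : Fin n) (j₀ : Fin d) (hi₀ : p i₀) (hj₀ : j₀ ∈ K) (hG : (i₀, j₀) ∈ G) :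
    ∃ C ∈ M, (∀ i, A i ⊆ C i) ∧ ∃ i, ∃ x ∈ C i, x ∉ A i := by
  classical
  have hsub : ∀ D ∈ M, ∀ i, D i ⊆ graphType G i := by
    intro D hD i j hj
    have : (i, j) ∈ (↑G : Set (Fin n × Fin d)) := hM.subgraph D hD hj
    simpa [graphType] using this
  have hGne : ∀ i, (graphType G i).Nonempty := fun i => (hM.isType A hA i).mono (hsub A hA i)
  set H : Fin n → Finset (Fin d) := fun i => refSet K (graphType G i) with hH
  have he : ElimClosed M := hM.elimination
  have hb : KeyBoundary H (below H M) :=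
    keyBoundary_ref _ _ K (keyBoundary_of_perm _ _ hM.boundary)
  have he' : ElimClosed (below H M) := elimClosed_below H M he
  let Q : Finset (Fin n) := Finset.univ.filter fun i => ¬ p i ∨ graphType G i ∩ K = ∅
  have hQ : ∀ i ∈ Q, A i ⊆ H i := by
    intro i hi j hj
    have hjG := hsub A hA i hj
    rcases (Finset.mem_filter.1 hi).2 with h | h
    · have hjK : j ∈ K := by
        by_contra hc
        exact h ((hp i j hj).2 hc)
      simp only [hH]
      rw [refSet_of_mem hjG hjK]
      exact Finset.mem_inter.2 ⟨hjG, hjK⟩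
    · simp only [hH, refSet]
      rw [h, if_neg (by simp)]
      exact hjG
  obtain ⟨D, hD, hDQ⟩ := combine A (below H M) he' (hM.isType A hA) Q (fun f hf =>
    cover_aux A f _ Q H (below H M) rfl (fun i => refSet_nonempty _ _ (hGne i))
      (fun D hD => hM.isType D hD.1) (fun D hD => hM.comparability A hA D hD.1) he' hb
      (fun i _ => hf i) (fun i hi => hQ i hi (hf i)))
  have hnQ : ∀ i, i ∉ Q → ∃ x ∈ D i, p i ∧ x ∈ K := by
    intro i hi
    have hi' : ¬ (¬ p i ∨ graphType G i ∩ K = ∅) := fun h =>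
      hi (Finset.mem_filter.2 ⟨Finset.mem_univ _, h⟩)
    push Not at hi'
    obtain ⟨x, hx⟩ := hM.isType D hD.1 i
    have hxH := hD.2 i hx
    simp only [hH, refSet] at hxH
    rw [if_pos hi'.2] at hxH
    exact ⟨x, hx, hi'.1, (Finset.mem_inter.1 hxH).2⟩
  have hi₀Q : i₀ ∉ Q := by
    intro h
    rcases (Finset.mem_filter.1 h).2 with h | h
    · exact h hi₀
    · have : j₀ ∈ graphType G i₀ ∩ K := Finset.mem_inter.2 ⟨by simpa [graphType] using hG, hj₀⟩
      rw [h] at this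
      simp at this
  obtain ⟨C, hC, hAC, i, x, hx, hpi, hxK⟩ := approach A M he hA (fun i x => p i ∧ x ∈ K) _ D hD.1
    rfl (fun i => by
      by_cases hi : i ∈ Q
      · exact Or.inl (hDQ i hi)
      · exact Or.inr (hnQ i hi)) ⟨i₀, hnQ i₀ hi₀Q⟩
  exact ⟨C, hC, hAC, i, x, hx, fun hxA => (hp i x hxA).1 hpi hxK⟩

lemma enlarge_of_not_conn {n d : ℕ} (hn : 0 < n)
    (G : Finset (Fin n × Fin d)) (hGconn : IsConn (↑G : Set (Fin n × Fin d)))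
    (M : Set (Fin n → Finset (Fin d))) (hM : IsGTOM G M)
    (A : Fin n → Finset (Fin d)) (hA : A ∈ M) (hnc : ¬ IsConn (typeEdges A)) :
    ∃ C ∈ M, (∀ i, A i ⊆ C i) ∧ ∃ i, ∃ x ∈ C i, x ∉ A i := by
  classical
  have hne : Nonempty (Fin n ⊕ Fin d) := ⟨Sum.inl ⟨0, hn⟩⟩
  have hnp : ¬ (bipGraph (typeEdges A)).Preconnected := fun h =>
    hnc ((SimpleGraph.connected_iff _).2 ⟨h, hne⟩)
  unfold SimpleGraph.Preconnected at hnp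
  push Not at hnp
  obtain ⟨u, v, huv⟩ := hnp
  let S : Fin n ⊕ Fin d → Prop := fun x => (bipGraph (typeEdges A)).Reachable u x
  have hS : ∀ i, ∀ j ∈ A i, (S (Sum.inl i) ↔ S (Sum.inr j)) := by
    intro i j hj
    have hadj : (bipGraph (typeEdges A)).Adj (Sum.inl i) (Sum.inr j) :=
      ⟨i, j, hj, Or.inl ⟨rfl, rfl⟩⟩
    exact ⟨fun h => h.trans hadj.reachable, fun h => h.trans hadj.symm.reachable⟩
  have hcross : ∃ i j, (i, j) ∈ G ∧ ¬ (S (Sum.inl i) ↔ S (Sum.inr j)) := by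
    by_contra hcon
    push Not at hcon
    have hadj : ∀ x y, (bipGraph (↑G : Set (Fin n × Fin d))).Adj x y → (S x ↔ S y) := by
      rintro x y ⟨i, j, hij, ⟨rfl, rfl⟩ | ⟨rfl, rfl⟩⟩
      · exact hcon i j hij
      · exact (hcon i j hij).symm
    obtain ⟨W⟩ := hGconn.preconnected u v
    have hw : ∀ x y, (bipGraph (↑G : Set (Fin n × Fin d))).Walk x y → (S x ↔ S y) := by
      intro x y W
      induction W with
      | nil => exact Iff.rfl
      | cons h _ ih => exact (hadj _ _ h).trans ih
    exact huv ((hw u v W).1 (SimpleGraph.Reachable.refl u))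
  obtain ⟨i, j, hij, hne'⟩ := hcross
  by_cases hi : S (Sum.inl i)
  · have hj : ¬ S (Sum.inr j) := fun h => hne' ⟨fun _ => h, fun _ => hi⟩
    exact enlarge G M hM A hA (fun i => S (Sum.inl i))
      (Finset.univ.filter fun j => ¬ S (Sum.inr j))
      (fun i j hj => by simpa using hS i j hj) i j hi (by simpa using hj) hij
  · have hj : S (Sum.inr j) := by
      by_contra h
      exact hne' ⟨fun h' => absurd h' hi, fun h' => absurd h' h⟩
    exact enlarge G M hM A hA (fun i => ¬ S (Sum.inl i))
      (Finset.univ.filter fun j => S (Sum.inr j))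
      (fun i j hj => by simpa using not_congr (hS i j hj)) i j hi (by simpa using hj) hij

/-- in a `G`-tropical oriented matroid, every type is contained in a
connected type. -/
theorem gtom_type_subset_connected {n d : ℕ} (hn : 0 < n) (hd : 0 < d)
    (G : Finset (Fin n × Fin d)) (hGconn : IsConn (↑G : Set (Fin n × Fin d)))
    (M : Set (Fin n → Finset (Fin d))) (hM : IsGTOM G M) :
    ∀ A ∈ M, ∃ B ∈ M, IsConn (typeEdges B) ∧ ∀ i, A i ⊆ B i := by
  classical
  have main : ∀ m : ℕ, ∀ A ∈ M, n * d - ∑ i, (A i).card = m →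
      ∃ B ∈ M, IsConn (typeEdges B) ∧ ∀ i, A i ⊆ B i := by
    intro m
    induction m using Nat.strong_induction_on with
    | _ m ih =>
      intro A hA hm
      by_cases hc : IsConn (typeEdges A)
      · exact ⟨A, hA, hc, fun i => Finset.Subset.refl _⟩
      obtain ⟨C, hC, hAC, i, x, hx, hxA⟩ := enlarge_of_not_conn hn G hGconn M hM A hA hc
      have hlt : ∑ i, (A i).card < ∑ i, (C i).card := by
        apply Finset.sum_lt_sum (fun i _ => Finset.card_le_card (hAC i))
        exact ⟨i, Finset.mem_univ _, Finset.card_lt_card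
          (Finset.ssubset_iff_of_subset (hAC i) |>.2 ⟨x, hx, hxA⟩)⟩
      have hle : ∑ i, (C i).card ≤ n * d := by
        calc ∑ i, (C i).card ≤ ∑ _i : Fin n, d :=
              Finset.sum_le_sum (fun i _ => by simpa using Finset.card_le_univ (C i))
          _ = n * d := by simp
      obtain ⟨B, hB, hBc, hCB⟩ := ih (n * d - ∑ i, (C i).card) (by omega) C hC rfl
      exact ⟨B, hB, hBc, fun i => (hAC i).trans (hCB i)⟩
  intro A hA
  exact main _ A hA rfl
end

section
/- Let n, d be positive integers, G a connected subgraph of K_{n,d}, and M a G-tropical oriented matroid. If A ∈ M is a type whose graph E(A) is not connected, then there exists a type B ∈ M with A_i ⊆ B_i for every i ∈ Fin n and B ≠ A (so the containment E(A) ⊊ E(B) is strict). -/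
open Finset Pointwise

/-- Auxiliary step relation between columns through a common row. -/
def stepRel {n d : ℕ} (A C : Fin n → Finset (Fin d)) (l l' : Fin d) : Prop :=
  ∃ i, l ∈ C i ∧ l' ∈ A i

/-- Directed-path form of compatibility. -/
def WC {n d : ℕ} (A C : Fin n → Finset (Fin d)) : Prop :=
  ∀ i k l, k ∈ A i → l ∈ C i → Relation.ReflTransGen (stepRel A C) k l → k ∈ C i

/-- Two-block refinement with the block `S` first. -/
def ref2 {n d : ℕ} (C : Fin n → Finset (Fin d)) (S : Finset (Fin d)) : Fin n → Finset (Fin d) :=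
  fun i => if (C i ∩ S).Nonempty then C i ∩ S else C i

/-- The consequences of the axioms that the argument uses. -/
structure Tom {n d : ℕ} (G : Fin n → Finset (Fin d)) (M : Set (Fin n → Finset (Fin d))) :
    Prop where
  ne : ∀ C ∈ M, ∀ i, (C i).Nonempty
  sub : ∀ C ∈ M, ∀ i, C i ⊆ G i
  bd : ∀ σ : Fin d → ℕ, Function.Injective σ →
    ∃ C ∈ M, ∀ i, ∀ x ∈ C i, ∀ y ∈ G i, σ x ≤ σ y
  sur : ∀ C ∈ M, ∀ S, ref2 C S ∈ M
  comp : ∀ A ∈ M, ∀ B ∈ M, WC A B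
  elim : ∀ A ∈ M, ∀ B ∈ M, ∀ i : Fin n, ∃ C ∈ M,
    C i = A i ∪ B i ∧ ∀ i', C i' = A i' ∨ C i' = B i' ∨ C i' = A i' ∪ B i'

lemma wc_path {n d : ℕ} {A C : Fin n → Finset (Fin d)}
    (h : Compatible (typeEdges A) (typeEdges C)) :
    ∀ (m : ℕ) (i : ℕ → Fin n) (l : ℕ → Fin d), (∀ t ≤ m, l t ∈ A (i t)) →
      (∀ t < m, l t ∈ C (i (t + 1))) → l m ∈ C (i 0) → l 0 ∈ C (i 0) := by
  intro m
  induction m using Nat.strong_induction_on with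
  | _ m ih =>
  intro i l hA hC hl
  rcases Nat.eq_zero_or_pos m with rfl | hm
  · exact hl
  by_cases hlinj : ∃ s t, s < t ∧ t ≤ m ∧ l s = l t
  · obtain ⟨s, t, hst, htm, e⟩ := hlinj
    have := ih (m - (t - s)) (by omega)
      (fun u => if u ≤ s then i u else i (u + (t - s)))
      (fun u => if u ≤ s then l u else l (u + (t - s))) ?_ ?_ ?_
    · simpa using this
    · intro u hu
      try dsimp only
      split_ifs with h1
      · exact hA u (by omega)
      · exact hA _ (by omega)
    · intro u hu
      try dsimp only
      by_cases h1 : u < s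
      · rw [if_pos (by omega), if_pos (by omega)]
        exact hC u (by omega)
      · rw [if_neg (by omega : ¬ u + 1 ≤ s)]
        have h2 : (if u ≤ s then l u else l (u + (t - s))) = l (u + (t - s)) := by
          split_ifs with h3
          · have : u = s := by omega
            subst this
            rw [e]; congr 1; omega
          · rfl
        rw [h2]
        have := hC (u + (t - s)) (by omega)
        have h4 : u + 1 + (t - s) = u + (t - s) + 1 := by omega
        rw [h4]; exact this
    · try dsimp only
      rw [if_pos (Nat.zero_le s)]
      split_ifs with h3
      · have : m - (t - s) = s := by omega
        have h4 : t = m := by omega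
        rw [this, e, h4]; exact hl
      · have : m - (t - s) + (t - s) = m := by omega
        rw [this]; exact hl
  by_cases hiinj : ∃ s t, s < t ∧ t ≤ m ∧ i s = i t
  · obtain ⟨s, t, hst, htm, e⟩ := hiinj
    rcases Nat.eq_zero_or_pos s with rfl | hs
    · refine ih (t - 1) (by omega) i l (fun u hu => hA u (by omega))
        (fun u hu => hC u (by omega)) ?_
      have := hC (t - 1) (by omega)
      rw [Nat.sub_add_cancel (by omega), ← e] at this
      exact this
    · have := ih (m - (t - s)) (by omega)
        (fun u => if u < s then i u else i (u + (t - s)))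
        (fun u => if u < s then l u else l (u + (t - s))) ?_ ?_ ?_
      · simpa [hs] using this
      · intro u hu
        try dsimp only
        split_ifs with h1
        · exact hA u (by omega)
        · exact hA _ (by omega)
      · intro u hu
        try dsimp only
        by_cases h1 : u + 1 < s
        · rw [if_pos h1, if_pos (by omega)]
          exact hC u (by omega)
        · rw [if_neg h1]
          by_cases h2 : u < s
          · rw [if_pos h2]
            have h3 : u + 1 = s := by omega
            have h4 : u + 1 + (t - s) = t := by omega
            rw [h4, ← e, ← h3]
            exact hC u (by omega)
          · rw [if_neg h2]
            have := hC (u + (t - s)) (by omega)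
            have h4 : u + 1 + (t - s) = u + (t - s) + 1 := by omega
            rw [h4]; exact this
      · try dsimp only
        rw [if_pos hs, if_neg (by omega)]
        have : m - (t - s) + (t - s) = m := by omega
        rw [this]; exact hl
  -- the generic case: a genuine cycle
  obtain ⟨k, rfl⟩ : ∃ k, m = k + 1 := ⟨m - 1, by omega⟩
  have key := h k (fun t => i t.val) (fun t => l t.val) ?_ ?_ ?_ ?_ 0
  · exact key.2.1
  · intro s t hst
    by_contra hne
    rcases Nat.lt_or_gt_of_ne (fun hh => hne (Fin.ext hh)) with h1 | h1
    · exact hiinj ⟨s, t, h1, by omega, hst⟩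
    · exact hiinj ⟨t, s, h1, by omega, hst.symm⟩
  · intro s t hst
    by_contra hne
    rcases Nat.lt_or_gt_of_ne (fun hh => hne (Fin.ext hh)) with h1 | h1
    · exact hlinj ⟨s, t, h1, by omega, hst⟩
    · exact hlinj ⟨t, s, h1, by omega, hst.symm⟩
  · intro t
    exact hA t (by omega)
  · intro t
    change l t.val ∈ C (i (t + 1 : Fin (k + 2)).val)
    rw [Fin.val_add_one]
    split_ifs with h1
    · subst h1
      exact hl
    · refine hC t ?_
      have : t.val ≠ k + 1 := fun hh => h1 (Fin.ext hh)
      omega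

lemma wc_of_compatible {n d : ℕ} {A C : Fin n → Finset (Fin d)}
    (h : Compatible (typeEdges A) (typeEdges C)) : WC A C := by
  intro i k l hk hl hr
  have : ∃ (m : ℕ) (p : ℕ → Fin n) (q : ℕ → Fin d), p 0 = i ∧ q 0 = k ∧ q m = l ∧
      (∀ t ≤ m, q t ∈ A (p t)) ∧ (∀ t < m, q t ∈ C (p (t + 1))) := by
    clear hl
    induction hr with
    | refl => exact ⟨0, fun _ => i, fun _ => k, rfl, rfl, rfl, fun _ _ => hk, by simp⟩
    | @tail b c _ hbc ih =>
      obtain ⟨m, p, q, h0, h1, h2, h3, h4⟩ := ih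
      obtain ⟨r, hr1, hr2⟩ := hbc
      refine ⟨m + 1, fun u => if u ≤ m then p u else r, fun u => if u ≤ m then q u else c,
        by simpa, by simpa, by simp, ?_, ?_⟩
      · intro t ht
        try dsimp only
        split_ifs with h5
        · exact h3 t h5
        · exact hr2
      · intro t ht
        try dsimp only
        rw [if_pos (by omega : t ≤ m)]
        split_ifs with h5
        · exact h4 t (by omega)
        · have : t = m := by omega
          rw [this, h2]; exact hr1
  obtain ⟨m, p, q, h0, h1, h2, h3, h4⟩ := this
  have := wc_path h m p q h3 h4 (by rw [h0, h2]; exact hl)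
  rwa [h0, h1] at this

lemma WC.mono {n d : ℕ} {A A' C : Fin n → Finset (Fin d)} (h : WC A C)
    (hA : ∀ i, A' i ⊆ A i) : WC A' C := by
  intro i k l hk hl hr
  refine h i k l (hA i hk) hl (Relation.ReflTransGen.mono ?_ _ _ hr)
  rintro x y ⟨r, h1, h2⟩
  exact ⟨r, h1, hA r h2⟩

lemma ref2_sub {n d : ℕ} (C : Fin n → Finset (Fin d)) (S : Finset (Fin d)) (i : Fin n) :
    ref2 C S i ⊆ C i := by
  unfold ref2
  split_ifs
  · exact Finset.inter_subset_left
  · exact subset_rfl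

/-- Types pushed as far as possible in the direction `S`. -/
def faceSet {n d : ℕ} (G : Fin n → Finset (Fin d)) (M : Set (Fin n → Finset (Fin d)))
    (S : Finset (Fin d)) : Set (Fin n → Finset (Fin d)) :=
  {C | C ∈ M ∧ ∀ i, C i ⊆ ref2 G S i}

lemma Tom.face {n d : ℕ} {G : Fin n → Finset (Fin d)} {M : Set (Fin n → Finset (Fin d))}
    (h : Tom G M) (S : Finset (Fin d)) : Tom (ref2 G S) (faceSet G M S) where
  ne C hC := h.ne C hC.1
  sub C hC := hC.2
  bd σ hσ := by
    set K := Finset.univ.sup σ + 1 with hK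
    have hlt : ∀ x, σ x < K := fun x =>
      Nat.lt_succ_of_le (Finset.le_sup (f := σ) (Finset.mem_univ x))
    obtain ⟨C, hC, hb⟩ := h.bd (fun x => if x ∈ S then σ x else σ x + K) (by
      intro x y hxy
      try dsimp only at hxy
      have h1 := hlt x
      have h2 := hlt y
      apply hσ
      split_ifs at hxy <;> omega)
    have hsub : ∀ i, C i ⊆ ref2 G S i := by
      intro i x hx
      have hxG := h.sub C hC i hx
      unfold ref2
      split_ifs with h1
      · obtain ⟨y, hy⟩ := h1
        rw [Finset.mem_inter] at hy ⊢
        refine ⟨hxG, ?_⟩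
        by_contra hxS
        have := hb i x hx y hy.1
        rw [if_neg hxS, if_pos hy.2] at this
        have := hlt y
        omega
      · exact hxG
    refine ⟨C, ⟨hC, hsub⟩, ?_⟩
    intro i x hx y hy
    have h1 := hb i x hx y (ref2_sub G S i hy)
    have hx' := hsub i hx
    unfold ref2 at hx' hy
    split_ifs at hx' hy with h2
    · rw [Finset.mem_inter] at hx' hy
      rwa [if_pos hx'.2, if_pos hy.2] at h1
    · have hx2 : x ∉ S := fun hh => h2 ⟨x, Finset.mem_inter.2 ⟨hx', hh⟩⟩
      have hy2 : y ∉ S := fun hh => h2 ⟨y, Finset.mem_inter.2 ⟨hy, hh⟩⟩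
      rw [if_neg hx2, if_neg hy2] at h1
      omega
  sur C hC T := ⟨h.sur C hC.1 T, fun i => (ref2_sub C T i).trans (hC.2 i)⟩
  comp A hA B hB := h.comp A hA.1 B hB.1
  elim A hA B hB i := by
    obtain ⟨C, hC, h1, h2⟩ := h.elim A hA.1 B hB.1 i
    refine ⟨C, ⟨hC, fun i' => ?_⟩, h1, h2⟩
    rcases h2 i' with e | e | e <;> rw [e]
    · exact hA.2 i'
    · exact hB.2 i'
    · exact Finset.union_subset (hA.2 i') (hB.2 i')

/-- Maximality of the family: partial types compatible with everything are contained in a type. -/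
def StarProp (n d m : ℕ) : Prop :=
  ∀ (G : Fin n → Finset (Fin d)) (M : Set (Fin n → Finset (Fin d))), Tom G M →
    ∀ (R : Finset (Fin n)), R.card ≤ m → ∀ A : Fin n → Finset (Fin d),
      (∀ i, A i ⊆ G i) → (∀ i, i ∉ R → A i = ∅) → (∀ i ∈ R, (A i).Nonempty) → (∀ C ∈ M, WC A C) →
      ∃ C ∈ M, ∀ i, A i ⊆ C i

/-- The directional statement. -/
def DirProp (n d m : ℕ) : Prop :=
  ∀ (G : Fin n → Finset (Fin d)) (M : Set (Fin n → Finset (Fin d))), Tom G M →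
    ∀ (R : Finset (Fin n)), R.card ≤ m → ∀ A ∈ M, ∀ S : Finset (Fin d),
      (∀ i ∈ R, A i ⊆ S ∨ Disjoint (A i) S) →
      (∃ i ∈ R, Disjoint (A i) S ∧ ¬ Disjoint (G i) S) →
      ∃ B ∈ M, (∀ i ∈ R, A i ⊆ B i) ∧ ∃ i ∈ R, Disjoint (A i) S ∧ ¬ Disjoint (B i) S

lemma exists_max_of {α : Type*} (p : α → Prop) (f : α → ℕ) (K : ℕ) (hK : ∀ a, f a ≤ K)
    (h : ∃ a, p a) : ∃ a, p a ∧ ∀ b, p b → f b ≤ f a := by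
  obtain ⟨a0, ha0⟩ := h
  by_contra hcon
  push Not at hcon
  have : ∀ N : ℕ, ∃ a, p a ∧ N ≤ f a := by
    intro N
    induction N with
    | zero => exact ⟨a0, ha0, Nat.zero_le _⟩
    | succ N ih =>
      obtain ⟨a, ha, hN⟩ := ih
      obtain ⟨b, hb, hlt⟩ := hcon a ha
      exact ⟨b, hb, by omega⟩
  obtain ⟨a, _, hN⟩ := this (K + 1)
  have := hK a
  omega

lemma not_disj {d : ℕ} {X S : Finset (Fin d)} : ¬ Disjoint X S ↔ ∃ x, x ∈ X ∧ x ∈ S :=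
  Finset.not_disjoint_iff

lemma dir_of_star {n d m : ℕ} (hs : ∀ m' < m, StarProp n d m') : DirProp n d m := by
  classical
  rintro G M hM R hR A hA S hsplit ⟨i0, hi0R, hi0A, hi0G⟩
  set R' := R.filter (fun i => A i ⊆ S ∨ Disjoint (G i) S) with hR'
  have hi0 : i0 ∉ R' := by
    intro hh
    rcases (Finset.mem_filter.1 hh).2 with h1 | h1
    · obtain ⟨x, hx⟩ := hM.ne A hA i0
      exact Finset.disjoint_left.1 hi0A hx (h1 hx)
    · exact hi0G h1
  have hcard : R'.card < R.card :=
    Finset.card_lt_card ⟨Finset.filter_subset _ _, fun hh => hi0 (hh hi0R)⟩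
  obtain ⟨C0, ⟨hC0M, hC0f⟩, hC0⟩ := hs R'.card (by omega) (ref2 G S) (faceSet G M S)
    (hM.face S) R' le_rfl (fun i => if i ∈ R' then A i else ∅) (by
      intro i
      try dsimp only
      split_ifs with h1
      · have hAG := hM.sub A hA i
        rcases (Finset.mem_filter.1 h1).2 with h2 | h2
        · unfold ref2
          split_ifs
          · exact Finset.subset_inter hAG h2
          · exact hAG
        · unfold ref2
          rw [if_neg (by
            rw [Finset.not_nonempty_iff_eq_empty]
            exact Finset.disjoint_iff_inter_eq_empty.1 h2)]
          exact hAG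
      · simp) (by
      intro i hi
      simp [hi]) (by
      intro i hi
      simpa [hi] using hM.ne A hA i) (by
      intro C hC
      refine (hM.comp A hA C hC.1).mono ?_
      intro i
      try dsimp only
      split_ifs
      · exact subset_rfl
      · simp)
  obtain ⟨C, ⟨hCM, hC1, hC2, i1, hi1, hi1R, hi1S⟩, hmax⟩ := exists_max_of
    (fun C : Fin n → Finset (Fin d) => C ∈ M ∧ (∀ i ∈ R', A i ⊆ C i) ∧
      (∀ i ∈ R, i ∉ R' → A i ⊆ C i ∨ ¬ Disjoint (C i) S) ∧
      ∃ i ∈ R, i ∉ R' ∧ ¬ Disjoint (C i) S)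
    (fun C => (R.filter (fun i => A i ⊆ C i)).card) R.card
    (fun C => Finset.card_filter_le _ _) (by
      have hface : ∀ i ∈ R, i ∉ R' → ¬ Disjoint (C0 i) S := by
        intro i hi hi'
        have h1 : ¬ Disjoint (G i) S := fun hh =>
          hi' (Finset.mem_filter.2 ⟨hi, Or.inr hh⟩)
        obtain ⟨x, hx⟩ := hM.ne C0 hC0M i
        have h2 := hC0f i hx
        unfold ref2 at h2
        rw [if_pos (by
          obtain ⟨y, hy⟩ := not_disj.1 h1
          exact ⟨y, Finset.mem_inter.2 hy⟩)] at h2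
        exact not_disj.2 ⟨x, hx, (Finset.mem_inter.1 h2).2⟩
      refine ⟨C0, hC0M, ?_, fun i hi hi' => Or.inr (hface i hi hi'),
        i0, hi0R, hi0, hface i0 hi0R hi0⟩
      intro i hi
      have := hC0 i
      simpa [hi] using this)
  have hdis : ∀ i ∈ R, i ∉ R' → Disjoint (A i) S := by
    intro i hi hi'
    rcases hsplit i hi with h1 | h1
    · exact absurd (Finset.mem_filter.2 ⟨hi, Or.inl h1⟩) hi'
    · exact h1
  by_cases hall : ∀ i ∈ R, A i ⊆ C i
  · exact ⟨C, hCM, hall, i1, hi1, hdis i1 hi1 hi1R, hi1S⟩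
  exfalso
  push Not at hall
  obtain ⟨i, hiR, hi⟩ := hall
  have hi' : i ∉ R' := fun hh => hi (hC1 i hh)
  have hiS : ¬ Disjoint (C i) S := (hC2 i hiR hi').resolve_left hi
  obtain ⟨E, hE, hEi, hEo⟩ := hM.elim A hA C hCM i
  have hEiS : ¬ Disjoint (E i) S := by
    obtain ⟨x, hx, hxS⟩ := not_disj.1 hiS
    exact not_disj.2 ⟨x, by rw [hEi]; exact Finset.mem_union_right _ hx, hxS⟩
  have hkeep : ∀ j, A j ⊆ C j → A j ⊆ E j := by
    intro j hj
    rcases hEo j with e | e | e <;> rw [e]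
    · exact hj
    · exact Finset.subset_union_left
  have hle := hmax E ⟨hE, fun j hj => hkeep j (hC1 j hj), ?_, i, hiR, hi', hEiS⟩
  · have hlt : (R.filter (fun i => A i ⊆ C i)).card < (R.filter (fun i => A i ⊆ E i)).card := by
      apply Finset.card_lt_card
      refine ⟨fun j hj => ?_, fun hh => ?_⟩
      · rw [Finset.mem_filter] at hj ⊢
        exact ⟨hj.1, hkeep j hj.2⟩
      · have : i ∈ R.filter (fun i => A i ⊆ E i) :=
          Finset.mem_filter.2 ⟨hiR, by rw [hEi]; exact Finset.subset_union_left⟩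
        exact hi (Finset.mem_filter.1 (hh this)).2
    try dsimp only at hle
    omega
  · intro j hj hj'
    rcases hEo j with e | e | e <;> rw [e]
    · exact Or.inl subset_rfl
    · exact hC2 j hj hj'
    · exact Or.inl Finset.subset_union_left

lemma star_of_dir {n d m : ℕ} (hs : ∀ m' < m, StarProp n d m') (hd : DirProp n d m) : StarProp n d m := by
  classical
  intro G M hM R hR A hAG hAR hARne hWC
  rcases R.eq_empty_or_nonempty with rfl | ⟨r, hr⟩
  · obtain ⟨C, hC, _⟩ := hM.bd (fun x => x.val) Fin.val_injective
    exact ⟨C, hC, fun i => by simp [hAR i (by simp)]⟩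
  set A' : Fin n → Finset (Fin d) := fun i => if i = r then ∅ else A i with hA'
  have hA'A : ∀ i, A' i ⊆ A i := by
    intro i
    simp only [hA']
    split_ifs
    · simp
    · exact subset_rfl
  have hA'ne : ∀ i, i ≠ r → A' i = A i := fun i hi => by simp [hA', hi]
  have hrcard : (R.erase r).card < R.card := Finset.card_erase_lt_of_mem hr
  have hIH : ∃ C, C ∈ M ∧ ∀ i, A' i ⊆ C i := by
    obtain ⟨C, hC, h⟩ := hs (R.erase r).card (by omega) G M hM (R.erase r) le_rfl A'
      (fun i => (hA'A i).trans (hAG i)) (by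
        intro i hi
        by_cases hir : i = r
        · simp [hA', hir]
        · rw [hA'ne i hir]
          exact hAR i (fun hh => hi (Finset.mem_erase.2 ⟨hir, hh⟩)))
      (by
        intro i hi
        rw [Finset.mem_erase] at hi
        rw [hA'ne i hi.1]
        exact hARne i hi.2)
      (fun C hC => (hWC C hC).mono hA'A)
    exact ⟨C, hC, h⟩
  obtain ⟨C, ⟨hCM, hCA⟩, hmax⟩ := exists_max_of
    (fun C : Fin n → Finset (Fin d) => C ∈ M ∧ ∀ i, A' i ⊆ C i)
    (fun C => (C r ∩ A r).card) (A r).card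
    (fun C => Finset.card_le_card Finset.inter_subset_right) hIH
  by_cases hall : A r ⊆ C r
  · refine ⟨C, hCM, fun i => ?_⟩
    by_cases hir : i = r
    · rw [hir]; exact hall
    · rw [← hA'ne i hir]; exact hCA i
  exfalso
  obtain ⟨k, hkA, hkC⟩ := Finset.not_subset.1 hall
  -- it suffices to enlarge the part of row r that is already reached
  suffices hD : ∃ D, (D ∈ M ∧ (∀ i, A' i ⊆ D i) ∧ C r ∩ A r ⊆ D r) ∧ k ∈ D r by
    obtain ⟨D, ⟨hDM, hDA, hDr⟩, hkD⟩ := hD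
    have h1 := hmax D ⟨hDM, hDA⟩
    have h2 : (C r ∩ A r).card < (D r ∩ A r).card := by
      apply Finset.card_lt_card
      refine ⟨Finset.subset_inter hDr Finset.inter_subset_right, fun hh => ?_⟩
      exact hkC (Finset.mem_inter.1 (hh (Finset.mem_inter.2 ⟨hkD, hkA⟩))).1
    try dsimp only at h1
    omega
  by_contra hno
  let reach : (Fin n → Finset (Fin d)) → Finset (Fin d) := fun D =>
    Finset.univ.filter (fun l => Relation.ReflTransGen (stepRel A' D) k l)
  have hreach : ∀ D l, l ∈ reach D ↔ Relation.ReflTransGen (stepRel A' D) k l := by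
    intro D l
    simp [reach]
  have hsep : ∀ D, (D ∈ M ∧ (∀ i, A' i ⊆ D i) ∧ C r ∩ A r ⊆ D r) → Disjoint (D r) (reach D) := by
    intro D hD
    rw [Finset.disjoint_left]
    intro l hl hlr
    rw [hreach] at hlr
    refine hno ⟨D, hD, hWC D hD.1 r k l hkA hl (Relation.ReflTransGen.mono ?_ _ _ hlr)⟩
    rintro x y ⟨i, h1, h2⟩
    exact ⟨i, h1, hA'A i h2⟩
  obtain ⟨D, hD, hDmax⟩ := exists_max_of
    (fun D : Fin n → Finset (Fin d) => D ∈ M ∧ (∀ i, A' i ⊆ D i) ∧ C r ∩ A r ⊆ D r)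
    (fun D => (reach D).card) d
    (fun D => by simpa using Finset.card_le_univ (reach D))
    ⟨C, hCM, hCA, Finset.inter_subset_left⟩
  set S := reach D with hS
  have hDr := hsep D hD
  have hkS : k ∈ S := (hreach D k).2 Relation.ReflTransGen.refl
  have hBr : ref2 D S r = D r := by
    unfold ref2
    rw [if_neg (by
      rw [Finset.not_nonempty_iff_eq_empty]
      exact Finset.disjoint_iff_inter_eq_empty.1 hDr)]
  have hAB : ∀ i, A' i ⊆ ref2 D S i := by
    intro i
    unfold ref2
    split_ifs with h1
    · obtain ⟨l, hl⟩ := h1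
      rw [Finset.mem_inter] at hl
      intro x hx
      refine Finset.mem_inter.2 ⟨hD.2.1 i hx, ?_⟩
      exact (hreach D x).2 (((hreach D l).1 hl.2).tail ⟨i, hl.1, hx⟩)
    · exact hD.2.1 i
  obtain ⟨B, hBM, hBsub, i, hiR, hiD, hiB⟩ := hd G M hM R hR (ref2 D S) (hM.sur D hD.1 S) S
    (by
      intro i _
      unfold ref2
      split_ifs with h1
      · exact Or.inl Finset.inter_subset_right
      · right
        rw [Finset.disjoint_iff_inter_eq_empty]
        exact Finset.not_nonempty_iff_eq_empty.1 h1)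
    ⟨r, hr, by rw [hBr]; exact hDr, not_disj.2 ⟨k, hAG r hkA, hkS⟩⟩
  have hA'R : ∀ i x, x ∈ A' i → i ∈ R := by
    intro i x hx
    by_contra hi
    have := hA'A i hx
    rw [hAR i hi] at this
    simp at this
  have hBgood : B ∈ M ∧ (∀ i, A' i ⊆ B i) ∧ C r ∩ A r ⊆ B r := by
    refine ⟨hBM, fun i x hx => hBsub i (hA'R i x hx) (hAB i hx), ?_⟩
    have := hBsub r hr
    rw [hBr] at this
    exact hD.2.2.trans this
  have hSB : S ⊆ reach B := by
    intro l hl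
    rw [hreach]
    have hl' := (hreach D l).1 hl
    clear hl
    induction hl' with
    | refl => exact Relation.ReflTransGen.refl
    | @tail b c hb hbc ih =>
      obtain ⟨j, h1, h2⟩ := hbc
      refine ih.tail ⟨j, hBsub j (hA'R j c h2) ?_, h2⟩
      have hbS : b ∈ D j ∩ S := Finset.mem_inter.2 ⟨h1, (hreach D b).2 hb⟩
      unfold ref2
      rw [if_pos ⟨b, hbS⟩]
      exact hbS
  obtain ⟨l, hlB, hlS⟩ := not_disj.1 hiB
  by_cases hir : i = r
  · subst hir
    exact Finset.disjoint_left.1 (hsep B hBgood) hlB (hSB hlS)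
  · obtain ⟨x, hx⟩ := hARne i hiR
    rw [← hA'ne i hir] at hx
    have hxB : x ∈ reach B :=
      (hreach B x).2 (((hreach B l).1 (hSB hlS)).tail ⟨i, hlB, hx⟩)
    have hxS : x ∉ S := Finset.disjoint_left.1 hiD (hAB i hx)
    have hlt : S.card < (reach B).card :=
      Finset.card_lt_card ⟨hSB, fun hh => hxS (hh hxB)⟩
    have := hDmax B hBgood
    try dsimp only at this
    omega

lemma star_all (n d m : ℕ) : StarProp n d m := by
  induction m using Nat.strong_induction_on with
  | _ m ih => exact star_of_dir ih (dir_of_star ih)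

lemma dir_all (n d m : ℕ) : DirProp n d m := dir_of_star (fun m' _ => star_all n d m')

/-- The ordered partition with the two blocks `S` and its complement. -/
def twoPart {d : ℕ} (S : Finset (Fin d)) (h1 : S.Nonempty) (h2 : Sᶜ.Nonempty) :
    OrderedPartition d where
  r := 2
  parts := fun k => if k = 0 then S else Sᶜ
  nonempty := by
    intro k
    split_ifs
    · exact h1
    · exact h2
  disjoint := by
    intro k l hkl
    fin_cases k <;> fin_cases l
    · exact absurd rfl hkl
    · simpa using disjoint_compl_right
    · simpa using disjoint_compl_left
    · exact absurd rfl hkl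
  covers := by
    intro j
    by_cases h : j ∈ S
    · exact ⟨0, by simpa using h⟩
    · exact ⟨1, by simpa using h⟩

lemma ref2_mem {n d : ℕ} {G : Finset (Fin n × Fin d)} {M : Set (Fin n → Finset (Fin d))}
    (h : IsGTOM G M) (C : Fin n → Finset (Fin d)) (hC : C ∈ M) (S : Finset (Fin d)) :
    ref2 C S ∈ M := by
  by_cases h1 : S.Nonempty
  · by_cases h2 : Sᶜ.Nonempty
    · refine h.surrounding C hC (twoPart S h1 h2) _ (fun i => ?_)
      by_cases h3 : (C i ∩ S).Nonempty
      · refine ⟨(0 : Fin 2), ?_, ?_, ?_⟩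
        · simp [twoPart, ref2, h3]
        · simpa [twoPart] using h3
        · intro l hl
          have hl' : l.val < 0 := hl
          omega
      · have h4 : C i ∩ S = ∅ := Finset.not_nonempty_iff_eq_empty.1 h3
        have h5 : C i ∩ Sᶜ = C i := by
          apply Finset.inter_eq_left.2
          intro x hx
          rw [Finset.mem_compl]
          intro hxS
          exact h3 ⟨x, Finset.mem_inter.2 ⟨hx, hxS⟩⟩
        refine ⟨(1 : Fin 2), ?_, ?_, ?_⟩
        · simp [twoPart, ref2, h3, h5]
        · simpa [twoPart, h5] using h.isType C hC i
        · intro l hl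
          have : l = (0 : Fin 2) := by
            change Fin 2 at l
            have hl' : l.val < 1 := hl
            exact Fin.ext (by simpa using hl')
          subst this
          simpa [twoPart] using h4
    · have : S = Finset.univ := by
        rw [Finset.not_nonempty_iff_eq_empty] at h2
        simpa using h2
      have e : ref2 C S = C := by
        funext i
        simp [ref2, this]
      rw [e]; exact hC
  · have e : ref2 C S = C := by
      funext i
      simp [ref2, Finset.not_nonempty_iff_eq_empty.1 h1]
    rw [e]; exact hC

lemma tom_of_gtom {n d : ℕ} {G : Finset (Fin n × Fin d)} {M : Set (Fin n → Finset (Fin d))}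
    (hG : ∀ i, (graphType G i).Nonempty) (h : IsGTOM G M) : Tom (graphType G) M where
  ne := h.isType
  sub := by
    intro C hC i x hx
    have : (i, x) ∈ (↑G : Set (Fin n × Fin d)) := h.subgraph C hC hx
    simpa [graphType] using this
  bd := by
    intro σ hσ
    have hmono := Tuple.monotone_sort σ
    choose f hf hmin using fun i => Finset.exists_min_image (graphType G i) σ (hG i)
    refine ⟨fun i => {f i}, h.boundary (Tuple.sort σ)⁻¹ _ ?_, ?_⟩
    · intro i
      refine ⟨f i, hf i, rfl, ?_⟩
      intro j' hj'
      by_contra hlt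
      push Not at hlt
      have h1 := hmono hlt.le
      have e1 : ∀ x, Tuple.sort σ ((Tuple.sort σ)⁻¹ x) = x :=
        fun x => (Tuple.sort σ).apply_symm_apply x
      simp only [Function.comp, e1] at h1
      have h2 := hσ (le_antisymm h1 (hmin i j' hj'))
      rw [h2] at hlt
      exact lt_irrefl _ hlt
    · intro i x hx y hy
      rw [Finset.mem_singleton] at hx
      rw [hx]
      exact hmin i y hy
  sur := ref2_mem h
  comp A hA B hB := wc_of_compatible (h.comparability A hA B hB)
  elim := h.elimination

lemma crossing {V : Type*} {H : SimpleGraph V} (U : Set V) {u v : V} (h : H.Reachable u v)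
    (hu : u ∈ U) (hv : v ∉ U) : ∃ x y, H.Adj x y ∧ x ∈ U ∧ y ∉ U := by
  obtain ⟨w⟩ := h
  induction w with
  | nil => exact absurd hu hv
  | @cons a b c hab p ih =>
    by_cases hb : b ∈ U
    · exact ih hb hv
    · exact ⟨a, b, hab, hu, hb⟩

/-- in a `G`-tropical oriented matroid, every disconnected type is strictly
contained in another type. -/
theorem gtom_disconnected_strict_subset {n d : ℕ} (hn : 0 < n) (hd : 0 < d)
    (G : Finset (Fin n × Fin d)) (hGconn : IsConn (↑G : Set (Fin n × Fin d)))
    (M : Set (Fin n → Finset (Fin d))) (hM : IsGTOM G M) :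
    ∀ A ∈ M, ¬ IsConn (typeEdges A) → ∃ B ∈ M, (∀ i, A i ⊆ B i) ∧ B ≠ A := by
  classical
  intro A hA hdisc
  have hG : ∀ i, (graphType G i).Nonempty := by
    intro i
    obtain ⟨j, hj⟩ := hM.isType A hA i
    have : (i, j) ∈ (↑G : Set (Fin n × Fin d)) := hM.subgraph A hA hj
    exact ⟨j, by simpa [graphType] using this⟩
  have hT := tom_of_gtom hG hM
  -- the claim follows from a splitting set `S`
  have main : ∀ (S : Finset (Fin d)) (i0 : Fin n) (j0 : Fin d), (i0, j0) ∈ G →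
      (∀ i, A i ⊆ S ∨ Disjoint (A i) S) → Disjoint (A i0) S → j0 ∈ S →
      ∃ B ∈ M, (∀ i, A i ⊆ B i) ∧ B ≠ A := by
    intro S i0 j0 hij hsplit hi0 hj0
    obtain ⟨B, hB, hAB, i, _, h1, h2⟩ := dir_all n d _ (graphType G) M hT Finset.univ le_rfl A hA S
      (fun i _ => hsplit i)
      ⟨i0, Finset.mem_univ _, hi0, not_disj.2 ⟨j0, by simpa [graphType] using hij, hj0⟩⟩
    refine ⟨B, hB, fun i => hAB i (Finset.mem_univ _), ?_⟩
    rintro rfl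
    exact h2 h1
  -- a connected component
  have hU : ∃ u v, ¬ (bipGraph (typeEdges A)).Reachable u v := by
    by_contra hcon
    push Not at hcon
    exact hdisc ((SimpleGraph.connected_iff _).2 ⟨hcon, ⟨Sum.inl ⟨0, hn⟩⟩⟩)
  obtain ⟨u, v, huv⟩ := hU
  have hadj : ∀ i j, j ∈ A i → (bipGraph (typeEdges A)).Adj (Sum.inl i) (Sum.inr j) :=
    fun i j hj => ⟨i, j, hj, Or.inl ⟨rfl, rfl⟩⟩
  have hiff : ∀ i j, j ∈ A i → ((bipGraph (typeEdges A)).Reachable u (Sum.inl i) ↔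
      (bipGraph (typeEdges A)).Reachable u (Sum.inr j)) := fun i j hj =>
    ⟨fun hh => hh.trans (hadj i j hj).reachable, fun hh => hh.trans (hadj i j hj).symm.reachable⟩
  obtain ⟨x, y, hxy, hx, hy⟩ := crossing {w | (bipGraph (typeEdges A)).Reachable u w}
    (hGconn.preconnected u v) (SimpleGraph.Reachable.refl u) huv
  simp only [Set.mem_setOf_eq] at hx hy
  obtain ⟨i0, j0, hij, (⟨rfl, rfl⟩ | ⟨rfl, rfl⟩)⟩ := hxy
  · refine main (Finset.univ.filter
      (fun j => ¬ (bipGraph (typeEdges A)).Reachable u (Sum.inr j))) i0 j0 hij ?_ ?_ ?_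
    · intro i
      by_cases hi : (bipGraph (typeEdges A)).Reachable u (Sum.inl i)
      · right
        rw [Finset.disjoint_left]
        intro j hj hj'
        exact (Finset.mem_filter.1 hj').2 ((hiff i j hj).1 hi)
      · left
        intro j hj
        exact Finset.mem_filter.2 ⟨Finset.mem_univ _, fun hh => hi ((hiff i j hj).2 hh)⟩
    · rw [Finset.disjoint_left]
      intro j hj hj'
      exact (Finset.mem_filter.1 hj').2 ((hiff i0 j hj).1 hx)
    · exact Finset.mem_filter.2 ⟨Finset.mem_univ _, hy⟩
  · refine main (Finset.univ.filter
      (fun j => (bipGraph (typeEdges A)).Reachable u (Sum.inr j))) i0 j0 hij ?_ ?_ ?_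
    · intro i
      by_cases hi : (bipGraph (typeEdges A)).Reachable u (Sum.inl i)
      · left
        intro j hj
        exact Finset.mem_filter.2 ⟨Finset.mem_univ _, (hiff i j hj).1 hi⟩
      · right
        rw [Finset.disjoint_left]
        intro j hj hj'
        exact hi ((hiff i j hj).2 (Finset.mem_filter.1 hj').2)
    · rw [Finset.disjoint_left]
      intro j hj hj'
      exact hy ((hiff i0 j hj).2 (Finset.mem_filter.1 hj').2)
    · exact Finset.mem_filter.2 ⟨Finset.mem_univ _, hx⟩
end

section
/- Let n, d be positive integers and let A and B be compatible (n,d)-types. Let J ⊆ Fin d be a set of elements all lying in the same connected component of the bipartite graph with edge set E(A) ∩ E(B) (i.e. any two elements of J are joined by a path using only edges in E(A) ∩ E(B)). Then for every position i ∈ Fin n for which both A_i ∩ J and B_i ∩ J are nonempty, one has A_i ∩ J = B_i ∩ J. -/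
open Finset Pointwise

/-- A closed alternating walk of length `2(k+1)` starting with the edge `(i, j)`. -/
def AltWalk {n d : ℕ} (A B : Set (Fin n × Fin d)) (i : Fin n) (j y : Fin d) (k : ℕ) : Prop :=
  ∃ (f : ℕ → Fin n) (g : ℕ → Fin d), f 0 = i ∧ g 0 = j ∧ g k = y ∧
    (∀ t ≤ k, (f t, g t) ∈ A) ∧ (∀ t < k, (f (t + 1), g t) ∈ B)

theorem Compatible.swap {n d : ℕ} {A B : Set (Fin n × Fin d)} (h : Compatible A B) :
    Compatible B A := by
  intro k i j hi hj h1 h2 t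
  have key := h k (fun t => i (-t)) (fun t => j (-t - 1))
    (fun a b hab => neg_injective (hi hab))
    (fun a b hab => by
      have := hj hab
      simpa using this)
    (fun t => by simpa using h2 (-t - 1))
    (fun t => by
      have := h1 (-t - 1)
      have e : -(t + 1) = -t - 1 := by abel
      simpa [e] using this)
    (-t - 1)
  have e1 : -(-t - 1) = t + 1 := by abel
  have e2 : t + 1 - 1 = t := by abel
  have e3 : -(-t - 1 + 1) = t := by abel
  simp only [e1, e2, e3] at key
  tauto

theorem altWalk_closed {n d : ℕ} {A B : Set (Fin n × Fin d)} (h : Compatible A B)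
    (i : Fin n) (j : Fin d) (hex : ∃ k y, (i, y) ∈ B ∧ AltWalk A B i j y k) : (i, j) ∈ B := by
  classical
  have hspec := Nat.find_spec hex
  have hmin := fun m => @Nat.find_min _ _ hex m
  generalize Nat.find hex = k at hspec hmin
  obtain ⟨y, hy, f, g, f0, g0, gk, hfA, hgB⟩ := hspec
  have hg : ∀ s t, s < t → t ≤ k → g s ≠ g t := by
    intro s t hst htk e
    refine hmin (k - (t - s)) (by omega) ⟨y, hy,
      fun u => if u ≤ s then f u else f (u + (t - s)),
      fun u => if u ≤ s then g u else g (u + (t - s)), by simpa, by simpa, ?_, ?_, ?_⟩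
    · dsimp only
      split_ifs with hc
      · have : k - (t - s) = s := by omega
        have h2 : t = k := by omega
        rw [this, e, h2, gk]
      · rw [Nat.sub_add_cancel (by omega), gk]
    · intro u hu
      dsimp only
      split_ifs with hc
      · exact hfA u (by omega)
      · exact hfA _ (by omega)
    · intro u hu
      dsimp only
      split_ifs with hc hd hd
      · exact hgB u (by omega)
      · omega
      · have : u = s := by omega
        subst this
        rw [e]
        have := hgB t (by omega)
        rwa [show u + 1 + (t - u) = t + 1 by omega]
      · have := hgB (u + (t - s)) (by omega)
        rwa [show u + 1 + (t - s) = u + (t - s) + 1 by omega]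
  have hf : ∀ s t, s < t → t ≤ k → f s ≠ f t := by
    intro s t hst htk e
    rcases Nat.eq_zero_or_pos s with rfl | hs
    · refine hmin (t - 1) (by omega) ⟨g (t - 1), ?_, f, g, f0, g0, rfl, ?_, ?_⟩
      · have := hgB (t - 1) (by omega)
        rwa [Nat.sub_add_cancel (by omega), ← e, f0] at this
      · exact fun u hu => hfA u (by omega)
      · exact fun u hu => hgB u (by omega)
    · refine hmin (k - (t - s)) (by omega) ⟨y, hy,
        fun u => if u < s then f u else f (u + (t - s)),
        fun u => if u < s then g u else g (u + (t - s)), by simpa [hs], by simpa [hs], ?_, ?_, ?_⟩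
      · dsimp only
        rw [if_neg (by omega), Nat.sub_add_cancel (by omega), gk]
      · intro u hu
        dsimp only
        split_ifs with hc
        · exact hfA u (by omega)
        · exact hfA _ (by omega)
      · intro u hu
        dsimp only
        split_ifs with hc hd hd
        · exact hgB u (by omega)
        · omega
        · have h2 : u + 1 = s := by omega
          rw [show u + 1 + (t - s) = t by omega, ← e, ← h2]
          exact hgB u (by omega)
        · have := hgB (u + (t - s)) (by omega)
          rwa [show u + 1 + (t - s) = u + (t - s) + 1 by omega]
  rcases k with _ | k
  · rw [← g0, gk]; exact hy
  · have inj : ∀ {X : Type} (φ : ℕ → X), (∀ s t, s < t → t ≤ k + 1 → φ s ≠ φ t) →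
        Function.Injective (fun t : Fin (k + 2) => φ t) := by
      intro X φ hφ a b hab
      rcases lt_trichotomy a b with hl | hl | hl
      · exact absurd hab (hφ _ _ hl (by omega))
      · exact hl
      · exact absurd hab.symm (hφ _ _ hl (by omega))
    have := h k (fun t => f t) (fun t => g t) (inj f hf) (inj g hg)
      (fun t => hfA t (by omega)) (fun t => by
        rw [Fin.val_add_one]
        split_ifs with hc
        · subst hc
          rw [f0, Fin.val_last, gk]; exact hy
        · apply hgB
          have := Fin.val_lt_last hc
          omega) 0
    have := this.2.1
    simpa [f0, g0] using this

theorem altWalk_of_reachable {n d : ℕ} {A B : Set (Fin n × Fin d)} (i : Fin n) (j : Fin d)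
    (hij : (i, j) ∈ A) (v : Fin n ⊕ Fin d)
    (hr : (bipGraph (A ∩ B)).Reachable (Sum.inr j) v) :
    Sum.elim (fun a => ∃ y k, (a, y) ∈ B ∧ AltWalk A B i j y k)
      (fun y => ∃ k, AltWalk A B i j y k) v := by
  rw [SimpleGraph.reachable_iff_reflTransGen] at hr
  induction hr with
  | refl => exact ⟨0, fun _ => i, fun _ => j, rfl, rfl, rfl, fun _ _ => hij, by simp⟩
  | tail _ hadj ih =>
    obtain ⟨a, b, hab, ⟨rfl, rfl⟩ | ⟨rfl, rfl⟩⟩ := hadj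
    · obtain ⟨y, k, hy, f, g, f0, g0, gk, hfA, hgB⟩ := ih
      refine ⟨k + 1, fun u => if u ≤ k then f u else a, fun u => if u ≤ k then g u else b,
        by simpa, by simpa, by simp, ?_, ?_⟩
      · intro t ht
        dsimp only
        split_ifs with hc
        · exact hfA t hc
        · exact hab.1
      · intro t ht
        dsimp only
        rw [if_pos (show t ≤ k by omega)]
        split_ifs with hc
        · exact hgB t (by omega)
        · have : t = k := by omega
          rw [this, gk]; exact hy
    · obtain ⟨k, hk⟩ := ih
      exact ⟨b, k, hab.2, hk⟩

theorem agree_aux {n d : ℕ} {A B : Set (Fin n × Fin d)} (h : Compatible A B)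
    (i : Fin n) (j j' : Fin d) (hij : (i, j) ∈ A) (hij' : (i, j') ∈ B)
    (hr : (bipGraph (A ∩ B)).Reachable (Sum.inr j) (Sum.inr j')) : (i, j) ∈ B := by
  obtain ⟨k, hk⟩ := altWalk_of_reachable i j hij _ hr
  exact altWalk_closed h i j ⟨k, j', hij', hk⟩

/-- if `A` and `B` are compatible types and `J` lies in a single connected
component of `E(A) ∩ E(B)`, then `A` and `B` agree on `J` at every position where both
meet `J`. -/
theorem compatible_agree {n d : ℕ} (hn : 0 < n) (hd : 0 < d)
    (A B : Fin n → Finset (Fin d)) (hA : IsType A) (hB : IsType B)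
    (hcomp : Compatible (typeEdges A) (typeEdges B))
    (J : Finset (Fin d))
    (hJ : ∀ j ∈ J, ∀ j' ∈ J,
      (bipGraph (typeEdges A ∩ typeEdges B)).Reachable (Sum.inr j) (Sum.inr j'))
    (i : Fin n) (h1 : (A i ∩ J).Nonempty) (h2 : (B i ∩ J).Nonempty) :
    A i ∩ J = B i ∩ J := by
  obtain ⟨a, ha⟩ := h1
  obtain ⟨b, hb⟩ := h2
  rw [Finset.mem_inter] at ha hb
  ext j
  simp only [Finset.mem_inter]
  constructor
  · rintro ⟨hj, hjJ⟩
    exact ⟨agree_aux hcomp i j b hj hb.1 (hJ j hjJ b hb.2), hjJ⟩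
  · rintro ⟨hj, hjJ⟩
    refine ⟨agree_aux hcomp.swap i j a hj ha.1 ?_, hjJ⟩
    rw [Set.inter_comm]
    exact hJ j hjJ a ha.2
end

section
/- Let n, d be positive integers and let J : Fin n → Finset (Fin d) with J i nonempty for every i. Let P = ∑_{i ∈ Fin n} conv{e_j : j ∈ J i} ⊆ (Fin d → ℝ) be the Minkowski sum of the convex hulls (e_j the standard basis vectors). If v is an extreme point of P (v ∈ Set.extremePoints ℝ P), then there exists a unique function f : Fin n → Fin d with f i ∈ J i for every i and v = ∑_{i ∈ Fin n} e_{f i}. -/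
open Finset Pointwise

/-- Two decompositions of an extreme point of a Minkowski sum coincide. -/
theorem extreme_sum_unique {n d : ℕ} (C : Fin n → Set (Fin d → ℝ)) (v : Fin d → ℝ)
    (hv : v ∈ Set.extremePoints ℝ (∑ i, C i)) (a b : Fin n → Fin d → ℝ)
    (ha : ∀ i, a i ∈ C i) (hb : ∀ i, b i ∈ C i) (hva : v = ∑ i, a i) (hvb : v = ∑ i, b i) :
    a = b := by
  classical
  have key : ∀ (a b : Fin n → Fin d → ℝ), (∀ i, a i ∈ C i) → (∀ i, b i ∈ C i) →
      v = ∑ i, a i → ∀ i, v - a i + b i ∈ ∑ i, C i := by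
    intro a b ha hb hva i
    have h1 : v - a i + b i = ∑ k, Function.update a i (b i) k := by
      rw [Finset.sum_update_of_mem (Finset.mem_univ i), hva,
        ← Finset.sum_sdiff (Finset.subset_univ {i})]
      simp [add_comm]
    rw [h1]
    refine Set.finsetSum_mem_finsetSum _ _ _ ?_
    intro k _
    by_cases hk : k = i
    · subst hk; simpa using hb k
    · simpa [hk] using ha k
  funext i
  have h := hv.2 (key a b ha hb hva i) (key b a hb ha hvb i) ?_
  · have h' : v - a i + b i = v := h
    have h2 : b i - a i = 0 := by
      have : v - a i + b i - v = 0 := by rw [h']; simp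
      rw [← this]; abel
    exact (sub_eq_zero.mp h2).symm
  · refine ⟨1/2, 1/2, by norm_num, by norm_num, by norm_num, ?_⟩
    ext k
    simp
    ring

/-- every extreme point of the generalized permutohedron
`∑ᵢ conv{e_j : j ∈ J i}` is of the form `∑ᵢ e_{f i}` with `f i ∈ J i` for a unique `f`. -/
theorem gPerm_extremePoint_unique_rep {n d : ℕ} (hn : 0 < n) (hd : 0 < d)
    (J : Fin n → Finset (Fin d)) (hJ : ∀ i, (J i).Nonempty)
    (v : Fin d → ℝ) (hv : v ∈ Set.extremePoints ℝ (gPerm J)) :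
    ∃! f : Fin n → Fin d, (∀ i, f i ∈ J i) ∧ v = ∑ i, Pi.single (f i) (1 : ℝ) := by
  have hP : gPerm J = convexHull ℝ (∑ i, (fun j => Pi.single j (1 : ℝ)) '' (J i : Set (Fin d))) := by
    rw [convexHull_sum]; rfl
  have hv2 := hv
  rw [hP] at hv2
  have hv3 := extremePoints_convexHull_subset hv2
  rw [Set.mem_finsetSum] at hv3
  obtain ⟨g, hg, hgv⟩ := hv3
  choose f hf hfg using fun i => hg (Finset.mem_univ i)
  have hmem : ∀ f : Fin n → Fin d, (∀ i, f i ∈ J i) → ∀ i, (Pi.single (f i) (1 : ℝ) : Fin d → ℝ) ∈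
      convexHull ℝ ((fun j => Pi.single j (1 : ℝ)) '' (J i : Set (Fin d))) :=
    fun f hf i => subset_convexHull ℝ _ ⟨f i, hf i, rfl⟩
  have hfv : v = ∑ i, Pi.single (f i) (1 : ℝ) := by
    rw [← hgv]
    exact Finset.sum_congr rfl fun i _ => (hfg i).symm
  refine ⟨f, ⟨hf, hfv⟩, ?_⟩
  rintro f2 ⟨hf2, hfv2⟩
  have h := extreme_sum_unique _ v hv _ _ (hmem f2 hf2) (hmem f hf) hfv2 hfv
  funext i
  have hi := congrFun (congrFun h i) (f2 i)
  by_contra hne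
  simp [Pi.single_apply, hne] at hi
end

section
/- Let n, d be positive integers and let G ⊆ Fin n × Fin d be a subgraph in which every i ∈ Fin n has at least one neighbor. Let Q_G ⊆ (Fin n → ℝ) × (Fin d → ℝ) be the convex hull of {(e_i, e_j) : (i,j) ∈ G}, and let P_G = ∑_{i ∈ Fin n} conv{e_j : (i,j) ∈ G} ⊆ (Fin d → ℝ). Then the slice of Q_G at the barycenter of the first factor satisfies {y ∈ (Fin d → ℝ) : ((fun _ => (1:ℝ)/n), y) ∈ Q_G} = (1/n) • P_G; equivalently, dilating this slice by a factor of n yields P_G. -/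
open Finset Pointwise

lemma rootPoly_weights {n d : ℕ} (G : Finset (Fin n × Fin d))
    (z : (Fin n → ℝ) × (Fin d → ℝ)) (hz : z ∈ rootPoly (↑G : Set (Fin n × Fin d))) :
    ∃ w : Fin n → Fin d → ℝ, (∀ i j, 0 ≤ w i j) ∧ (∀ i j, (i, j) ∉ G → w i j = 0) ∧
      (∀ i, z.1 i = ∑ j, w i j) ∧ (∀ j, z.2 j = ∑ i, w i j) := by
  refine convexHull_min (t := {z | ∃ w : Fin n → Fin d → ℝ, (∀ i j, 0 ≤ w i j) ∧
      (∀ i j, (i, j) ∉ G → w i j = 0) ∧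
      (∀ i, z.1 i = ∑ j, w i j) ∧ (∀ j, z.2 j = ∑ i, w i j)}) ?_ ?_ hz
  · rintro _ ⟨⟨a, b⟩, hab, rfl⟩
    refine ⟨fun i j => if i = a ∧ j = b then 1 else 0, ?_, ?_, ?_, ?_⟩
    · intro i j
      dsimp only
      split_ifs <;> norm_num
    · intro i j hij
      have : ¬ (i = a ∧ j = b) := by
        rintro ⟨rfl, rfl⟩
        exact hij (by simpa using hab)
      simp [this]
    · intro i
      by_cases h : i = a <;> simp [rootVert, Pi.single_apply, h]
    · intro j
      by_cases h : j = b <;> simp [rootVert, Pi.single_apply, h]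
  · rintro x ⟨u, hu0, huG, hu1, hu2⟩ y ⟨v, hv0, hvG, hv1, hv2⟩ a b ha hb hab
    refine ⟨fun i j => a * u i j + b * v i j, ?_, ?_, ?_, ?_⟩
    · intro i j
      have := hu0 i j
      have := hv0 i j
      positivity
    · intro i j hij
      simp [huG i j hij, hvG i j hij]
    · intro i
      simp [hu1, hv1, Finset.sum_add_distrib, Finset.mul_sum]
    · intro i
      simp [hu2, hv2, Finset.sum_add_distrib, Finset.mul_sum]

lemma single_mem_rootPoly {n d : ℕ} (G : Finset (Fin n × Fin d)) (i : Fin n)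
    (g : Fin d → ℝ)
    (hg : g ∈ convexHull ℝ ((fun j => (Pi.single j (1 : ℝ) : Fin d → ℝ)) '' ↑(graphType G i))) :
    ((Pi.single i 1 : Fin n → ℝ), g) ∈ rootPoly (↑G : Set (Fin n × Fin d)) := by
  refine convexHull_min (t := {g | ((Pi.single i 1 : Fin n → ℝ), g) ∈
    rootPoly (↑G : Set (Fin n × Fin d))}) ?_ ?_ hg
  · rintro _ ⟨j, hj, rfl⟩
    refine subset_convexHull ℝ _ ⟨(i, j), ?_, rfl⟩
    simpa [graphType] using hj
  · intro x hx y hy a b ha hb hab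
    have := (convex_convexHull ℝ (rootVert '' (↑G : Set (Fin n × Fin d)))) hx hy ha hb hab
    simp only [Prod.smul_mk, Prod.mk_add_mk, ← add_smul, hab, one_smul] at this
    exact this

/-- Cayley trick: slicing the root polytope `Q_G` at the barycenter of the
first factor yields the generalized permutohedron `P_G`, scaled by `1/n`. -/
theorem rootPoly_slice_eq_gPerm {n d : ℕ} (hn : 0 < n) (hd : 0 < d)
    (G : Finset (Fin n × Fin d)) (hGn : ∀ i : Fin n, ∃ j, (i, j) ∈ G) :
    {y : Fin d → ℝ | ((fun _ => (1 : ℝ) / n : Fin n → ℝ), y) ∈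
        rootPoly (↑G : Set (Fin n × Fin d))} =
      ((1 : ℝ) / n) • gPerm (graphType G) := by
  have hn' : (n : ℝ) ≠ 0 := by positivity
  ext y
  rw [Set.mem_smul_set]
  constructor
  · intro hy
    obtain ⟨w, h0, hG, h1, h2⟩ := rootPoly_weights G _ hy
    refine ⟨∑ i, fun j => n * w i j, ?_, ?_⟩
    · rw [gPerm, Set.mem_fintype_sum]
      refine ⟨fun i j => n * w i j, fun i => ?_, rfl⟩
      have hs : ∑ j ∈ graphType G i, n * w i j = 1 := by
        rw [← Finset.mul_sum, Finset.sum_subset (Finset.subset_univ _), ← h1]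
        · field_simp
        · intro j _ hj
          exact hG i j (by simpa [graphType] using hj)
      have hc := (convex_convexHull ℝ ((fun j => (Pi.single j (1 : ℝ) : Fin d → ℝ)) ''
        ↑(graphType G i))).sum_mem (t := graphType G i) (w := fun j => n * w i j)
        (z := fun j => Pi.single j 1)
        (fun j _ => mul_nonneg (Nat.cast_nonneg n) (h0 i j)) hs
        (fun j hj => subset_convexHull ℝ _ ⟨j, hj, rfl⟩)
      convert hc using 1
      ext j
      by_cases hj : (i, j) ∈ G
      · simp [Finset.sum_apply, Pi.single_apply, graphType, hj]
      · simp [Finset.sum_apply, Pi.single_apply, graphType, hj, hG i j hj]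
    · ext j
      have := h2 j
      simp only [Pi.smul_apply, Finset.sum_apply, smul_eq_mul, ← Finset.mul_sum, ← this]
      field_simp
  · rintro ⟨p, hp, rfl⟩
    rw [gPerm, Set.mem_fintype_sum] at hp
    obtain ⟨g, hg, rfl⟩ := hp
    have hc := (convex_convexHull ℝ (rootVert '' (↑G : Set (Fin n × Fin d)))).sum_mem
      (t := Finset.univ) (w := fun _ : Fin n => (1 : ℝ) / n)
      (z := fun i => ((Pi.single i 1 : Fin n → ℝ), g i))
      (fun _ _ => by positivity) (by simp [hn'])
      (fun i _ => single_mem_rootPoly G i _ (hg i))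
    change _ ∈ convexHull ℝ (rootVert '' (↑G : Set (Fin n × Fin d)))
    convert hc using 1
    ext j
    · simp [Prod.fst_sum, Finset.sum_apply, Pi.single_apply]
    · simp [Prod.snd_sum, Finset.sum_apply, Finset.mul_sum]
end
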